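/- Let D be a positive nonsquare integer and let (x, y) be a positive integer solution of x² − D y² = 1 with y = p₁^{n₁} p₂^{n₂} y′, where p₁, p₂ are primes not dividing D and n₁, n₂ are positive integers. If every prime divisor of y′ divides D, then x + y√D = ε, or ε², or ε³, or ε⁴, or ε⁶, or ε^{q^r} for some odd prime q and positive integer r, where ε = x₁ + y₁√D and (x₁, y₁) is the fundamental solution of x² − D y² = 1. -/

import Mathlib

namespace Stormer

def F : ℕ → ℤ → ℤ → ℤ
  | 0, _, _ => 1
  | k + 1, a, b => (a + b) * F k a b + 2 * a * F k b a

lemma F_pow (E x y : ℤ) (k : ℕ) :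
    (⟨x, y⟩ : ℤ√E) ^ (2 * k + 1) =
      ⟨x * F k (E * y ^ 2) (x ^ 2), y * F k (x ^ 2) (E * y ^ 2)⟩ := by
  induction k with
  | zero => simp [F]
  | succ k ih =>
    have : 2 * (k + 1) + 1 = (2 * k + 1) + 2 := by ring
    rw [this, pow_add, ih]
    ext <;> simp [F, pow_two] <;> ring

lemma F_expand (a b : ℤ) (k : ℕ) :
    (∃ s, 3 * F (k + 1) a b = 3 * (2 * k + 3) * a ^ (k + 1)
        + (2 * k + 3) * (k + 1) * (2 * k + 1) * a ^ k * b + b ^ 2 * s) ∧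
    (∃ t, F (k + 1) b a = a ^ (k + 1) + (2 * k + 3) * (k + 1) * a ^ k * b + b ^ 2 * t) := by
  induction k with
  | zero => exact ⟨⟨0, by simp [F]; ring⟩, ⟨0, by simp [F]; ring⟩⟩
  | succ k ih =>
    obtain ⟨⟨s, hs⟩, ⟨t, ht⟩⟩ := ih
    constructor
    · refine ⟨(2 * k + 3) * (k + 1) * (2 * k + 1) * a ^ k + (a + b) * s
        + 6 * a * t, ?_⟩
      rw [F]
      have : 3 * ((a + b) * F (k + 1) a b + 2 * a * F (k + 1) b a)
        = (a + b) * (3 * F (k + 1) a b) + 6 * a * F (k + 1) b a := by ring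
      rw [this, hs, ht]; push_cast; ring
    · have hF : ∃ u, F (k + 1) a b = (2 * k + 3) * a ^ (k + 1) + b * u := by
        clear hs ht s t
        induction k with
        | zero => exact ⟨1, by simp [F]; ring⟩
        | succ k ih =>
          obtain ⟨u, hu⟩ := ih
          have hG : ∀ k, ∃ v, F k b a = a ^ k + b * v := by
            intro k
            induction k with
            | zero => exact ⟨0, by simp [F]⟩
            | succ k ih => 
              obtain ⟨v, hv⟩ := ih
              exact ⟨a ^ k + (b + a) * v + 2 * F k a b, by rw [F, hv]; ring⟩
          obtain ⟨v, hv⟩ := hG (k + 1)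
          exact ⟨(2 * k + 3) * a ^ (k + 1) + (a + b) * u + 2 * a * v, by
            rw [F, hu, hv]; push_cast; ring⟩
      obtain ⟨u, hu⟩ := hF
      refine ⟨(2 * k + 3) * (k + 1) * a ^ k + (a + b) * t + 2 * u, ?_⟩
      rw [F, ht, hu]; push_cast; ring

lemma F_mod (a b : ℤ) (k : ℕ) :
    (∃ s, F k a b = (2 * k + 1) * a ^ k + b * s) ∧ (∃ t, F k b a = a ^ k + b * t) := by
  induction k with
  | zero => exact ⟨⟨0, by simp [F]⟩, ⟨0, by simp [F]⟩⟩
  | succ k ih =>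
    obtain ⟨⟨s, hs⟩, ⟨t, ht⟩⟩ := ih
    constructor
    · exact ⟨(2 * k + 1) * a ^ k + (a + b) * s + 2 * a * t, by
        rw [F, hs, ht]; push_cast; ring⟩
    · exact ⟨a ^ k + (b + a) * t + 2 * F k a b, by rw [F, ht]; ring⟩

lemma F_mono (k : ℕ) : ∀ a b a' b' t : ℤ, 0 ≤ a → 0 ≤ b → 0 ≤ t → t * a ≤ a' → t * b ≤ b' →
    0 ≤ F k a b ∧ t ^ k * F k a b ≤ F k a' b' := by
  induction k with
  | zero => intros; simp [F]
  | succ k ih =>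
    intro a b a' b' t ha hb ht h1 h2
    obtain ⟨p1, p2⟩ := ih a b a' b' t ha hb ht h1 h2
    obtain ⟨p3, p4⟩ := ih b a b' a' t hb ha ht h2 h1
    have ha' : 0 ≤ a' := le_trans (by positivity) h1
    have hb' : 0 ≤ b' := le_trans (by positivity) h2
    refine ⟨by rw [F]; positivity, ?_⟩
    rw [F, F]
    calc t ^ (k + 1) * ((a + b) * F k a b + 2 * a * F k b a)
        = (t * a + t * b) * (t ^ k * F k a b) + 2 * (t * a) * (t ^ k * F k b a) := by ring
      _ ≤ (a' + b') * F k a' b' + 2 * a' * F k b' a' := by gcongr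

lemma F_size (k : ℕ) : ∀ a b : ℤ, 3 ≤ a → 3 ≤ b → 7 ≤ a + b → 7 ^ k ≤ F k a b := by
  induction k with
  | zero => intros; simp [F]
  | succ k ih =>
    intro a b ha hb hab
    have h1 := ih a b ha hb hab
    have h2 := ih b a hb ha (by linarith)
    have h3 : (0 : ℤ) < 7 ^ k := by positivity
    rw [F, pow_succ]
    nlinarith [mul_nonneg (show (0 : ℤ) ≤ a by linarith) (show 0 ≤ F k b a by linarith)]

lemma seven_pow (k : ℕ) (hk : 1 ≤ k) : (2 * k + 1 : ℤ) < 7 ^ k := by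
  induction k, hk using Nat.le_induction with
  | base => norm_num
  | succ k hk ih => rw [pow_succ]; push_cast; linarith

lemma exists_p (z : ℤ) (hz : 1 < z) : ∃ p : ℕ, p.Prime ∧ (p : ℤ) ∣ z := by
  obtain ⟨p, hp, h⟩ := Int.exists_prime_and_dvd (n := z) (by omega)
  refine ⟨p.natAbs, Int.prime_iff_natAbs_prime.mp hp, ?_⟩
  rwa [Int.natAbs_dvd]

lemma p_eq {p q : ℕ} (hp : p.Prime) (hq : q.Prime) (h : (p : ℤ) ∣ q) : p = q :=
  (Nat.prime_dvd_prime_iff_eq hp hq).mp (by exact_mod_cast h)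

/-- primes dividing `b` and `F` equal `q`. -/
lemma p_dvd_F {p q k : ℕ} (a b : ℤ) (hp : p.Prime) (hq : q.Prime) (hk : q = 2 * k + 1)
    (hc : IsCoprime a b) (hb : (p : ℤ) ∣ b) (hF : (p : ℤ) ∣ F k a b) : p = q := by
  obtain ⟨s, hs⟩ := (F_mod a b k).1
  have hpz := Nat.prime_iff_prime_int.mp hp
  have h1 : (p : ℤ) ∣ (2 * k + 1) * a ^ k := by
    have : (2 * k + 1) * a ^ k = F k a b - b * s := by rw [hs]; ring
    rw [this]; exact dvd_sub hF (hb.mul_right _)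
  rcases hpz.dvd_or_dvd h1 with h | h
  · apply p_eq hp hq; rw [hk]; push_cast; exact h
  · exact absurd (hc.isUnit_of_dvd' (hpz.dvd_of_dvd_pow h) hb) hpz.not_isUnit

lemma sq_not_dvd {q k : ℕ} (a b : ℤ) (hq : q.Prime) (hk : q = 2 * k + 1) (h5 : q ≠ 3)
    (hc : IsCoprime a b) (hb : (q : ℤ) ∣ b) : ¬ (q : ℤ) ^ 2 ∣ F k a b := by
  intro hF
  have hqz := Nat.prime_iff_prime_int.mp hq
  obtain ⟨k, rfl⟩ : ∃ j, k = j + 1 := by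
    cases k with
    | zero => exact absurd hk hq.one_lt.ne'
    | succ k => exact ⟨k, rfl⟩
  obtain ⟨s, hs⟩ := (F_expand a b k).1
  have hqk : (q : ℤ) = 2 * k + 3 := by rw [hk]; push_cast; ring
  obtain ⟨c, hcb⟩ := hb
  obtain ⟨f, hf⟩ := hF
  rw [← hqk, hf, hcb] at hs
  have hq0 : (q : ℤ) ≠ 0 := hqz.ne_zero
  have h : (q : ℤ) ∣ 3 * a ^ (k + 1) := by
    refine ⟨3 * f - (k + 1) * (2 * k + 1) * a ^ k * c - c ^ 2 * s, ?_⟩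
    apply mul_left_cancel₀ hq0
    linear_combination -hs
  rcases hqz.dvd_or_dvd h with h | h
  · exact h5 (p_eq hq Nat.prime_three (by exact_mod_cast h))
  · exact hqz.not_isUnit (hc.isUnit_of_dvd' (hqz.dvd_of_dvd_pow h) ⟨c, hcb⟩)

/-- a prime divisor of `F` not dividing `b` -/
lemma exists_F {q k : ℕ} (a b : ℤ) (hq : q.Prime) (hk : q = 2 * k + 1)
    (hc : IsCoprime a b) (ha : 3 ≤ a) (hb : 3 ≤ b) (hab : 7 ≤ a + b)
    (hsq : (q : ℤ) ∣ b → ¬ (q : ℤ) ^ 2 ∣ F k a b) :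
    ∃ s : ℕ, s.Prime ∧ (s : ℤ) ∣ F k a b ∧ ¬ (s : ℤ) ∣ b := by
  by_contra! hcon
  have hk1 : 1 ≤ k := by have := hq.two_le; omega
  have hlt : (q : ℤ) < F k a b := by
    have h1 := F_size k a b ha hb hab
    have h2 := seven_pow k hk1
    rw [hk]; push_cast; linarith
  have hq2 : (2 : ℤ) ≤ q := by exact_mod_cast hq.two_le
  obtain ⟨p, hp, hpF⟩ := exists_p (F k a b) (by linarith)
  have hpb := hcon p hp hpF
  have := p_dvd_F a b hp hq hk hc hpb hpF
  subst this
  obtain ⟨f, hf⟩ := hpF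
  obtain ⟨p', hp', hp'f⟩ := exists_p f (by nlinarith)
  have h' : (p' : ℤ) ∣ F k a b := by rw [hf]; exact hp'f.mul_left _
  have := p_dvd_F a b hp' hq hk hc (hcon p' hp' h') h'
  subst this
  apply hsq hpb
  rw [hf, pow_two]
  exact mul_dvd_mul_left _ hp'f

/-- M1 -/
lemma exists_U {q k : ℕ} (x E : ℤ) (hx : 2 ≤ x) (hE : x ^ 2 = 1 + E) (hq : q.Prime)
    (hk : q = 2 * k + 1) : ∃ s : ℕ, s.Prime ∧ (s : ℤ) ∣ F k (x ^ 2) E ∧ ¬ (s : ℤ) ∣ E := by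
  have hc : IsCoprime (x ^ 2) E := ⟨1, -1, by rw [hE]; ring⟩
  by_cases h3 : q = 3
  · subst h3
    obtain rfl : k = 1 := by omega
    by_contra! hcon
    have hF : F 1 (x ^ 2) E = (2 * x - 1) * (2 * x + 1) := by simp [F]; linear_combination - hE
    obtain ⟨p, hp, h⟩ := exists_p (2 * x - 1) (by linarith)
    obtain ⟨p', hp', h'⟩ := exists_p (2 * x + 1) (by linarith)
    have d : (p : ℤ) ∣ F 1 (x ^ 2) E := by rw [hF]; exact h.mul_right _
    have d' : (p' : ℤ) ∣ F 1 (x ^ 2) E := by rw [hF]; exact h'.mul_left _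
    have e := p_dvd_F _ _ hp hq hk hc (hcon p hp d) d
    have e' := p_dvd_F _ _ hp' hq hk hc (hcon p' hp' d') d'
    subst e; subst e'
    push_cast at h h'
    omega
  · exact exists_F _ _ hq hk hc (by nlinarith) (by nlinarith) (by nlinarith)
      (fun hb => sq_not_dvd _ _ hq hk h3 hc hb)

/-- M2 -/
lemma exists_V {q k : ℕ} (x E : ℤ) (hx : 2 ≤ x) (hE : x ^ 2 = 1 + E) (hq : q.Prime)
    (hk : q = 2 * k + 1) : ∃ s : ℕ, s.Prime ∧ (s : ℤ) ∣ F k E (x ^ 2) ∧ ¬ (s : ℤ) ∣ x := by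
  have hc : IsCoprime E (x ^ 2) := ⟨-1, 1, by rw [hE]; ring⟩
  obtain ⟨s, h1, h2, h3⟩ := exists_F E (x ^ 2) hq hk hc (by nlinarith) (by nlinarith) (by nlinarith)
    (fun hb => by
      by_cases h3 : q = 3
      · subst h3
        obtain rfl : k = 1 := by omega
        have h := (Nat.prime_iff_prime_int.mp hq).dvd_of_dvd_pow hb
        obtain ⟨c, hc⟩ := h
        have hF : F 1 E (x ^ 2) = 4 * x ^ 2 - 3 := by simp [F]; linear_combination - 3 * hE
        rw [hF, hc]; push_cast
        ring_nf; omega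
      · exact sq_not_dvd _ _ hq hk h3 hc hb)
  exact ⟨s, h1, h2, fun h => h3 (h.trans (Dvd.intro_left _ (by rw [pow_two])))⟩

lemma im_dvd (E : ℤ) (e : ℤ√E) (n : ℕ) : e.im ∣ (e ^ n).im := by
  induction n with
  | zero => simp
  | succ n ih =>
    rw [pow_succ, Zsqrtd.im_mul]
    exact dvd_add (Dvd.intro_left _ rfl) (ih.mul_right _)

lemma im_dvd_im (E : ℤ) (e : ℤ√E) {m n : ℕ} (h : m ∣ n) : (e ^ m).im ∣ (e ^ n).im := by
  obtain ⟨c, rfl⟩ := h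
  rw [pow_mul]; exact im_dvd _ _ _

lemma norm_pow (E x y : ℤ) (hE : x ^ 2 = 1 + E * y ^ 2) (n : ℕ) :
    ((⟨x, y⟩ : ℤ√E) ^ n).re ^ 2 = 1 + E * ((⟨x, y⟩ : ℤ√E) ^ n).im ^ 2 := by
  induction n with
  | zero => simp
  | succ n ih =>
    rw [pow_succ (⟨x, y⟩ : ℤ√E) n, Zsqrtd.re_mul, Zsqrtd.im_mul]
    linear_combination (((⟨x, y⟩ : ℤ√E) ^ n).re ^ 2 - E * ((⟨x, y⟩ : ℤ√E) ^ n).im ^ 2) * hE + ih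

lemma not_dvd_both (E x : ℤ) (hE : x ^ 2 = 1 + E) {p : ℕ} (hp : p.Prime) {m n : ℕ}
    (hn : 1 < n) (h : Nat.Coprime m n)
    (h1 : (p : ℤ) ∣ ((⟨x, 1⟩ : ℤ√E) ^ m).im) (h2 : (p : ℤ) ∣ ((⟨x, 1⟩ : ℤ√E) ^ n).im) : False := by
  obtain ⟨u, hu⟩ := Nat.exists_mul_mod_eq_one_of_coprime h hn
  have hpz := Nat.prime_iff_prime_int.mp hp
  have key : m * u = n * (m * u / n) + 1 := by
    have := Nat.div_add_mod (m * u) n; omega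
  set v := m * u / n
  have d1 : (p : ℤ) ∣ ((⟨x, 1⟩ : ℤ√E) ^ (m * u)).im := h1.trans (im_dvd_im _ _ ⟨u, rfl⟩)
  have d2 : (p : ℤ) ∣ ((⟨x, 1⟩ : ℤ√E) ^ (n * v)).im := h2.trans (im_dvd_im _ _ ⟨v, rfl⟩)
  rw [key, pow_succ, Zsqrtd.im_mul] at d1
  simp only [mul_one] at d1
  have d3 := (dvd_add_left (d2.mul_right x)).mp d1
  have hN := norm_pow E x 1 (by linarith) (n * v)
  have : (p : ℤ) ∣ 1 := by
    have e : (1 : ℤ) = ((⟨x, 1⟩ : ℤ√E) ^ (n * v)).re ^ 2 - E * ((⟨x, 1⟩ : ℤ√E) ^ (n * v)).im ^ 2 := by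
      linarith
    rw [e]
    exact dvd_sub (dvd_pow d3 two_ne_zero) ((dvd_pow d2 two_ne_zero).mul_left _)
  exact hpz.not_isUnit (isUnit_of_dvd_one this)

def Three (E : ℤ) (z : ℤ) : Prop :=
  ∃ s t w : ℕ, s.Prime ∧ t.Prime ∧ w.Prime ∧ s ≠ t ∧ s ≠ w ∧ t ≠ w ∧
    (s : ℤ) ∣ z ∧ (t : ℤ) ∣ z ∧ (w : ℤ) ∣ z ∧ ¬ (s : ℤ) ∣ E ∧ ¬ (t : ℤ) ∣ E ∧ ¬ (w : ℤ) ∣ E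

lemma not_both {p : ℕ} (hp : p.Prime) {E X Y : ℤ} (h : X ^ 2 = 1 + E * Y ^ 2)
    (h1 : (p : ℤ) ∣ X) (h2 : (p : ℤ) ∣ E * Y) : False := by
  have hpz := Nat.prime_iff_prime_int.mp hp
  have : (p : ℤ) ∣ 1 := by
    have e : (1 : ℤ) = X ^ 2 - E * Y * Y := by linarith
    rw [e]
    exact dvd_sub (dvd_pow h1 two_ne_zero) (h2.mul_right _)
  exact hpz.not_isUnit (isUnit_of_dvd_one this)

lemma three_two_q {q : ℕ} (x E : ℤ) (hx : 2 ≤ x) (hE : x ^ 2 = 1 + E) (hq : q.Prime)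
    (ho : Odd q) : Three E ((⟨x, 1⟩ : ℤ√E) ^ (2 * q)).im := by
  obtain ⟨k, hk⟩ := ho
  obtain ⟨s, hs, hsx⟩ := exists_p x (by linarith)
  obtain ⟨t, ht, htV, htx⟩ := exists_V x E hx hE hq hk
  obtain ⟨w, hw, hwU, hwE⟩ := exists_U x E hx hE hq hk
  have hP := F_pow E x 1 k
  rw [← hk] at hP
  simp only [one_pow, mul_one, one_mul] at hP
  have hN := norm_pow E x 1 (by linarith) q
  have him : ((⟨x, 1⟩ : ℤ√E) ^ (2 * q)).im = 2 * (x * F k E (x ^ 2)) * F k (x ^ 2) E := by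
    rw [mul_comm 2 q, pow_mul, pow_two, hP, Zsqrtd.im_mul]; simp only; ring
  rw [hP] at hN
  simp only at hN
  have hsX : (s : ℤ) ∣ x * F k E (x ^ 2) := hsx.mul_right _
  have htX : (t : ℤ) ∣ x * F k E (x ^ 2) := htV.mul_left _
  refine ⟨s, t, w, hs, ht, hw, ?_, ?_, ?_, ?_, ?_, ?_, ?_, ?_, hwE⟩
  · rintro rfl; exact htx hsx
  · rintro rfl; exact not_both hs hN hsX (hwU.mul_left _)
  · rintro rfl; exact not_both ht hN htX (hwU.mul_left _)
  · rw [him]; exact (hsX.mul_left _).mul_right _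
  · rw [him]; exact (htX.mul_left _).mul_right _
  · rw [him]; exact hwU.mul_left _
  · exact fun h => not_both hs hN hsX (h.mul_right _)
  · exact fun h => not_both ht hN htX (h.mul_right _)

lemma three_eight (x E : ℤ) (hx : 2 ≤ x) (hE : x ^ 2 = 1 + E) :
    Three E ((⟨x, 1⟩ : ℤ√E) ^ 8).im := by
  obtain ⟨x2, hx2⟩ : ∃ x2, x2 = 2 * x ^ 2 - 1 := ⟨_, rfl⟩
  obtain ⟨x4, hx4⟩ : ∃ x4, x4 = 2 * x2 ^ 2 - 1 := ⟨_, rfl⟩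
  have h2 : 7 ≤ x2 := by nlinarith
  have h4 : 7 ≤ x4 := by nlinarith
  have e2 : (⟨x, 1⟩ : ℤ√E) ^ 2 = ⟨x2, 2 * x⟩ := by
    rw [pow_two]; ext
    · simp only [Zsqrtd.re_mul]; rw [hx2]; linear_combination -hE
    · simp only [Zsqrtd.im_mul]; ring
  have e4 : (⟨x, 1⟩ : ℤ√E) ^ 4 = ⟨x4, 4 * x * x2⟩ := by
    have : 4 = 2 * 2 := rfl
    rw [this, pow_mul, e2, pow_two]; ext
    · simp only [Zsqrtd.re_mul]; rw [hx4, hx2]; linear_combination (-4 * x ^ 2) * hE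
    · simp only [Zsqrtd.im_mul]; ring
  have e8 : ((⟨x, 1⟩ : ℤ√E) ^ 8).im = 8 * x * x2 * x4 := by
    have : 8 = 4 * 2 := rfl
    rw [this, pow_mul, e4, pow_two, Zsqrtd.im_mul]; simp only; ring
  have n2 := norm_pow E x 1 (by linarith) 2
  have n4 := norm_pow E x 1 (by linarith) 4
  rw [e2] at n2; rw [e4] at n4
  simp only at n2 n4
  obtain ⟨s, hs, hsx⟩ := exists_p x (by linarith)
  obtain ⟨t, ht, htx⟩ := exists_p x2 (by linarith)
  obtain ⟨w, hw, hwx⟩ := exists_p x4 (by linarith)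
  rw [e8]
  refine ⟨s, t, w, hs, ht, hw, ?_, ?_, ?_, ?_, ?_, ?_, ?_, ?_, ?_⟩
  · rintro rfl; exact not_both hs n2 htx ((hsx.mul_left _).mul_left _)
  · rintro rfl; exact not_both hs n4 hwx (((hsx.mul_left _).mul_right _).mul_left _)
  · rintro rfl; exact not_both ht n4 hwx ((htx.mul_left _).mul_left _)
  · exact (((hsx.mul_left _).mul_right _).mul_right _)
  · exact ((htx.mul_left _).mul_right _)
  · exact hwx.mul_left _
  · exact fun h => not_both (Y := 1) hs (by linarith) hsx (h.mul_right _)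
  · exact fun h => not_both ht n2 htx (h.mul_right _)
  · exact fun h => not_both hw n4 hwx (h.mul_right _)

lemma dvd_of_primes {P q r : ℕ} (hP : P ≠ 0) (hq : q.Prime) (hr : r.Prime) (hqr : q ≠ r)
    (h : ∀ p : ℕ, p.Prime → p ∣ P → (p = q ∨ p = r) ∧ ¬ p ^ 2 ∣ P) : P ∣ q * r := by
  have hsf : Squarefree P := by
    rw [Nat.squarefree_iff_prime_squarefree]
    intro p hp hpp
    exact (h p hp ((Dvd.intro _ rfl).trans hpp)).2 (by rwa [pow_two])
  rw [← Nat.prod_primeFactors_of_squarefree hsf, ← Finset.prod_pair (f := fun p => p) hqr]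
  apply Finset.prod_dvd_prod_of_subset
  intro p hp
  rw [Nat.mem_primeFactors] at hp
  simpa using (h p hp.1 hp.2.1).1

/-- If `q ∣ U_r` then `q² ∤ U_{qr}/U_r`. -/
lemma sq_not {q r i j : ℕ} (x E P : ℤ) (hE : x ^ 2 = 1 + E) (hq : q.Prime) (hr : r.Prime)
    (hi : q = 2 * i + 1) (hj : r = 2 * j + 1)
    (hqE : ¬ (q : ℤ) ∣ E) (hqU : (q : ℤ) ∣ ((⟨x, 1⟩ : ℤ√E) ^ r).im)
    (hP : P ∣ F i (((⟨x, 1⟩ : ℤ√E) ^ r).re ^ 2) (E * ((⟨x, 1⟩ : ℤ√E) ^ r).im ^ 2)) :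
    ¬ (q : ℤ) ^ 2 ∣ P := by
  intro hd
  by_cases h3 : q = 3
  · subst h3
    have h3x : (3 : ℤ) ∣ x := by
      push_cast at hqE
      by_contra hx
      have : x % 3 = 1 ∨ x % 3 = 2 := by omega
      have hx2 : x ^ 2 % 3 = 1 := by
        rcases this with h | h <;> simp [pow_two, Int.mul_emod, h]
      omega
    apply not_dvd_both E x hE hq (m := 2) (n := r) hr.one_lt _ _ hqU
    · rw [hj]; simp
    · rw [pow_two, Zsqrtd.im_mul]; push_cast; omega
  · have hN := norm_pow E x 1 (by linarith) r
    exact sq_not_dvd _ _ hq hi h3 ⟨1, -1, by rw [hN]; ring⟩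
      ((dvd_pow hqU two_ne_zero).mul_left _) (hd.trans hP)

lemma three_qr {q r : ℕ} (x E : ℤ) (hx : 2 ≤ x) (hE : x ^ 2 = 1 + E) (hq : q.Prime)
    (hr : r.Prime) (hqr : q ≠ r) (hqo : Odd q) (hro : Odd r) :
    Three E ((⟨x, 1⟩ : ℤ√E) ^ (q * r)).im := by
  obtain ⟨i, hi⟩ := hqo
  obtain ⟨j, hj⟩ := hro
  have hi1 : 1 ≤ i := by have := hq.two_le; omega
  have hj1 : 1 ≤ j := by have := hr.two_le; omega
  obtain ⟨s, hs, hsU, hsE⟩ := exists_U x E hx hE hq hi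
  obtain ⟨t, ht, htU, htE⟩ := exists_U x E hx hE hr hj
  have hPq := F_pow E x 1 i
  have hPr := F_pow E x 1 j
  rw [← hi] at hPq; rw [← hj] at hPr
  simp only [one_pow, mul_one, one_mul] at hPq hPr
  have hUq : ((⟨x, 1⟩ : ℤ√E) ^ q).im = F i (x ^ 2) E := by rw [hPq]
  have hUr : ((⟨x, 1⟩ : ℤ√E) ^ r).im = F j (x ^ 2) E := by rw [hPr]
  have hXq : ((⟨x, 1⟩ : ℤ√E) ^ q).re = x * F i E (x ^ 2) := by rw [hPq]
  have hNq := norm_pow E x 1 (by linarith) q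
  have hNr := norm_pow E x 1 (by linarith) r
  have hA := F_pow E ((⟨x, 1⟩ : ℤ√E) ^ q).re ((⟨x, 1⟩ : ℤ√E) ^ q).im j
  have hB := F_pow E ((⟨x, 1⟩ : ℤ√E) ^ r).re ((⟨x, 1⟩ : ℤ√E) ^ r).im i
  rw [← hj] at hA; rw [← hi] at hB
  change ((⟨x, 1⟩ : ℤ√E) ^ q) ^ r = _ at hA
  change ((⟨x, 1⟩ : ℤ√E) ^ r) ^ q = _ at hB
  rw [← pow_mul] at hA hB
  rw [mul_comm r q] at hB
  have hcop : Nat.Coprime q r := (Nat.coprime_primes hq hr).mpr hqr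
  have hnb : ∀ p : ℕ, p.Prime → (p : ℤ) ∣ ((⟨x, 1⟩ : ℤ√E) ^ q).im →
      (p : ℤ) ∣ ((⟨x, 1⟩ : ℤ√E) ^ r).im → False := fun p hp h1 h2 =>
    not_dvd_both E x hE hp hr.one_lt hcop h1 h2
  have hsn : ∀ (P : ℤ), ¬ (q : ℤ) ∣ E → (q : ℤ) ∣ ((⟨x, 1⟩ : ℤ√E) ^ r).im → _ → _ :=
    fun P => sq_not x E P hE hq hr hi hj
  have hrn : ∀ (P : ℤ), ¬ (r : ℤ) ∣ E → (r : ℤ) ∣ ((⟨x, 1⟩ : ℤ√E) ^ q).im → _ → _ :=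
    fun P => sq_not x E P hE hr hq hj hi
  have hA' := congrArg Zsqrtd.im hA
  have hB' := congrArg Zsqrtd.im hB
  have hE3 : 3 ≤ E := by nlinarith
  have hUrpos : 0 < F j (x ^ 2) E :=
    lt_of_lt_of_le (by positivity) (F_size j (x ^ 2) E (by linarith) hE3 (by linarith))
  have hsizeU := F_size i (x ^ 2) E (by linarith) hE3 (by linarith)
  have hsizeX := F_size i E (x ^ 2) hE3 (by linarith) (by linarith)
  have hUqpos : 0 < F i (x ^ 2) E := lt_of_lt_of_le (by positivity) hsizeU
  have hbig : (49 ^ i) ^ j * F j (x ^ 2) E ≤ F j (((⟨x, 1⟩ : ℤ√E) ^ q).re ^ 2)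
      (E * ((⟨x, 1⟩ : ℤ√E) ^ q).im ^ 2) := by
    have h49 : (49 : ℤ) ^ i = (7 ^ i) ^ 2 := by rw [← pow_mul, mul_comm, pow_mul]; norm_num
    refine (F_mono j (x ^ 2) E _ _ (49 ^ i) (by positivity) (by linarith) (by positivity) ?_ ?_).2
    · rw [hXq, h49, mul_pow, mul_comm]; gcongr
    · rw [hUq, h49, mul_comm]; gcongr
  rw [hA'] at hB'
  simp only at hA' hB'
  rw [hA']
  generalize ((⟨x, 1⟩ : ℤ√E) ^ q).re = Xq at *
  generalize ((⟨x, 1⟩ : ℤ√E) ^ r).re = Xr at *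
  generalize ((⟨x, 1⟩ : ℤ√E) ^ q).im = Uq at *
  generalize ((⟨x, 1⟩ : ℤ√E) ^ r).im = Ur at *
  rw [← hUq] at hsU hUqpos
  rw [← hUr] at htU hUrpos hbig
  have hcopU : IsCoprime Ur Uq := by
    rw [Int.isCoprime_iff_gcd_eq_one]
    by_contra hg
    obtain ⟨p, hp, hpg⟩ := Nat.exists_prime_and_dvd hg
    have : (p : ℤ) ∣ (Int.gcd Ur Uq : ℤ) := by exact_mod_cast hpg
    exact hnb p hp (this.trans (Int.gcd_dvd_right ..)) (this.trans (Int.gcd_dvd_left ..))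
  obtain ⟨P, hAP⟩ : Ur ∣ F j (Xq ^ 2) (E * Uq ^ 2) :=
    hcopU.dvd_of_dvd_mul_left (Dvd.intro _ hB'.symm)
  have hBP : F i (Xr ^ 2) (E * Ur ^ 2) = Uq * P := by
    apply mul_left_cancel₀ hUrpos.ne'
    rw [← hB', hAP]; ring
  have hPA : P ∣ F j (Xq ^ 2) (E * Uq ^ 2) := Dvd.intro_left _ hAP.symm
  have hPB : P ∣ F i (Xr ^ 2) (E * Ur ^ 2) := Dvd.intro_left _ hBP.symm
  have hPbig : (q : ℤ) * r < P := by
    have h1 : (49 ^ i) ^ j ≤ P := by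
      rw [hAP, mul_comm Ur] at hbig
      exact le_of_mul_le_mul_right hbig hUrpos
    have h2 : (7 : ℤ) ^ i * 7 ^ j ≤ (49 ^ i) ^ j := by
      rw [show (49 : ℤ) = 7 ^ 2 by norm_num, ← pow_mul, ← pow_mul, ← pow_add]
      apply pow_le_pow_right₀ (by norm_num)
      nlinarith
    have h3 := seven_pow i hi1
    have h4 := seven_pow j hj1
    have h5 : (q : ℤ) * r < 7 ^ i * 7 ^ j := by
      rw [hi, hj]; push_cast
      exact mul_lt_mul'' h3 h4 (by positivity) (by positivity)
    linarith
  have hcA : IsCoprime (Xq ^ 2) (E * Uq ^ 2) := ⟨1, -1, by rw [hNq]; ring⟩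
  have hcB : IsCoprime (Xr ^ 2) (E * Ur ^ 2) := ⟨1, -1, by rw [hNr]; ring⟩
  have c1 : ∀ p : ℕ, p.Prime → (p : ℤ) ∣ P → (p : ℤ) ∣ E * Uq ^ 2 → p = r :=
    fun p hp h1 h2 => p_dvd_F _ _ hp hr hj hcA h2 (h1.trans hPA)
  have c2 : ∀ p : ℕ, p.Prime → (p : ℤ) ∣ P → (p : ℤ) ∣ E * Ur ^ 2 → p = q :=
    fun p hp h1 h2 => p_dvd_F _ _ hp hq hi hcB h2 (h1.trans hPB)
  have c3 : ∀ p : ℕ, p.Prime → (p : ℤ) ∣ P → ¬ (p : ℤ) ∣ E := fun p hp h1 h2 =>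
    hqr ((c2 p hp h1 (h2.mul_right _)).symm.trans (c1 p hp h1 (h2.mul_right _)))
  obtain ⟨w, hw, hwP, hw1, hw2⟩ : ∃ w : ℕ, w.Prime ∧ (w : ℤ) ∣ P ∧ ¬ (w : ℤ) ∣ Uq ∧
      ¬ (w : ℤ) ∣ Ur := by
    by_contra! hcon
    have hP0 : 0 < P := lt_of_le_of_lt (by positivity) hPbig
    lift P to ℕ using hP0.le
    have : P ∣ q * r := by
      apply dvd_of_primes (by rintro rfl; simp at hP0) hq hr hqr
      intro p hp hpP
      have hpP' : (p : ℤ) ∣ (P : ℤ) := by exact_mod_cast hpP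
      by_cases hpU : (p : ℤ) ∣ Uq
      · have := c1 p hp hpP' ((dvd_pow hpU two_ne_zero).mul_left _)
        subst this
        exact ⟨Or.inr rfl, fun h => hrn P (c3 p hp hpP') hpU hPA (by exact_mod_cast h)⟩
      · have hpU := hcon p hp hpP' hpU
        have := c2 p hp hpP' ((dvd_pow hpU two_ne_zero).mul_left _)
        subst this
        exact ⟨Or.inl rfl, fun h => hsn P (c3 p hp hpP') hpU hPB (by exact_mod_cast h)⟩
    have := Nat.le_of_dvd (Nat.mul_pos hq.pos hr.pos) this
    have h' : q * r < P := by exact_mod_cast hPbig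
    omega
  refine ⟨s, t, w, hs, ht, hw, ?_, ?_, ?_, hsU.mul_right _, ?_, ?_, hsE, htE, c3 w hw hwP⟩
  · rintro rfl; exact hnb s hs hsU htU
  · rintro rfl; exact hw1 hsU
  · rintro rfl; exact hw2 htU
  · rw [hB']; exact htU.mul_right _
  · exact (hwP.trans hPA).mul_left _

lemma Three.mono {E z z' : ℤ} (h : Three E z) (hz : z ∣ z') : Three E z' := by
  obtain ⟨s, t, w, hs, ht, hw, h1, h2, h3, h4, h5, h6, h7⟩ := h
  exact ⟨s, t, w, hs, ht, hw, h1, h2, h3, h4.trans hz, h5.trans hz, h6.trans hz, h7⟩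

lemma classify (m : ℕ) (hm : m ≠ 0) (h8 : ¬ 8 ∣ m)
    (h2 : ∀ q : ℕ, q.Prime → Odd q → ¬ 2 * q ∣ m)
    (hqr : ∀ q r : ℕ, q.Prime → r.Prime → q ≠ r → Odd q → Odd r → ¬ q * r ∣ m) :
    m = 1 ∨ m = 2 ∨ m = 4 ∨ ∃ q r : ℕ, q.Prime ∧ Odd q ∧ 0 < r ∧ m = q ^ r := by
  by_cases h : ∃ q : ℕ, q.Prime ∧ Odd q ∧ q ∣ m
  · obtain ⟨q, hq, hqo, hqm⟩ := h
    right; right; right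
    have huniq : ∀ {d : ℕ}, d.Prime → d ∣ m → d = q := by
      intro d hd hdm
      by_contra hne
      have hc : Nat.Coprime d q := (Nat.coprime_primes hd hq).mpr hne
      have hdq := hc.mul_dvd_of_dvd_of_dvd hdm hqm
      rcases hd.eq_two_or_odd' with rfl | hdo
      · exact h2 q hq hqo hdq
      · exact hqr d q hd hq hne hdo hqo hdq
    have := Nat.eq_prime_pow_of_unique_prime_dvd hm huniq
    refine ⟨q, _, hq, hqo, ?_, this⟩
    rw [List.length_pos_iff_ne_nil]
    intro h0
    rw [h0] at this
    simp at this
    subst this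
    exact hq.one_lt.ne' (Nat.dvd_one.mp hqm)
  · push Not at h
    have := Nat.eq_prime_pow_of_unique_prime_dvd (p := 2) hm (fun {d} hd hdm => by
      rcases hd.eq_two_or_odd' with h' | h'
      · exact h'
      · exact absurd hdm (h d hd h'))
    generalize m.primeFactorsList.length = n at this
    subst this
    have : n < 3 := by
      by_contra hn
      exact h8 (pow_dvd_pow 2 (by omega : 3 ≤ n))
    interval_cases n <;> simp

lemma scale (D x y : ℤ) (n : ℕ) : ((⟨x, y⟩ : ℤ√D) ^ n) =
    ⟨((⟨x, 1⟩ : ℤ√(D * y ^ 2)) ^ n).re, y * ((⟨x, 1⟩ : ℤ√(D * y ^ 2)) ^ n).im⟩ := by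
  induction n with
  | zero => ext <;> simp
  | succ n ih =>
    rw [pow_succ, ih, pow_succ (⟨x, 1⟩ : ℤ√(D * y ^ 2)) n]
    ext
    · simp only [Zsqrtd.re_mul]; ring
    · simp only [Zsqrtd.im_mul]; ring

lemma real_pow (D x y : ℤ) (hD : 0 < D) (n : ℕ) :
    (((⟨x, y⟩ : ℤ√D) ^ n).re : ℝ) + (((⟨x, y⟩ : ℤ√D) ^ n).im : ℝ) * Real.sqrt (D : ℝ) =
      ((x : ℝ) + (y : ℝ) * Real.sqrt (D : ℝ)) ^ n := by
  have hs : Real.sqrt (D : ℝ) ^ 2 = D := Real.sq_sqrt (by exact_mod_cast hD.le)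
  induction n with
  | zero => simp
  | succ n ih =>
    rw [pow_succ, pow_succ, ← ih, Zsqrtd.re_mul, Zsqrtd.im_mul]
    push_cast
    linear_combination (- (((⟨x, y⟩ : ℤ√D) ^ n).im : ℝ) * y) * hs

end Stormer

/-- Mei–Sun extension of Störmer's theorem: a positive solution of
`x² - D y² = 1` with `y = p₁^{n₁} p₂^{n₂} y'`, `p₁, p₂` primes not dividing `D`,
and every prime divisor of `y'` dividing `D`, is `ε`, `ε²`, `ε³`, `ε⁴`, `ε⁶` or
`ε^{q^r}` for some odd prime `q` and `r ≥ 1`. -/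
theorem stormer_two_primes (D : ℤ) (hD : 0 < D) (hns : ¬ IsSquare D)
    (x₁ y₁ : ℤ) (hx₁ : 0 < x₁) (hy₁ : 0 < y₁)
    (hsol₁ : x₁ ^ 2 - D * y₁ ^ 2 = 1)
    (hmin : ∀ u v : ℤ, 0 < u → 0 < v → u ^ 2 - D * v ^ 2 = 1 →
      (x₁ : ℝ) + (y₁ : ℝ) * Real.sqrt (D : ℝ) ≤ (u : ℝ) + (v : ℝ) * Real.sqrt (D : ℝ))
    (x y : ℤ) (hx : 0 < x) (hy : 0 < y)
    (hsol : x ^ 2 - D * y ^ 2 = 1)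
    (p₁ p₂ : ℕ) (hp₁ : p₁.Prime) (hp₂ : p₂.Prime)
    (hp₁D : ¬ (p₁ : ℤ) ∣ D) (hp₂D : ¬ (p₂ : ℤ) ∣ D)
    (n₁ n₂ : ℕ) (hn₁ : 0 < n₁) (hn₂ : 0 < n₂)
    (y' : ℤ) (hyy : y = (p₁ : ℤ) ^ n₁ * (p₂ : ℤ) ^ n₂ * y')
    (hdiv : ∀ q : ℕ, q.Prime → (q : ℤ) ∣ y' → (q : ℤ) ∣ D) :
    ∃ m : ℕ, (m = 1 ∨ m = 2 ∨ m = 3 ∨ m = 4 ∨ m = 6 ∨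
        ∃ q r : ℕ, q.Prime ∧ Odd q ∧ 0 < r ∧ m = q ^ r) ∧
      (x : ℝ) + (y : ℝ) * Real.sqrt (D : ℝ) =
        ((x₁ : ℝ) + (y₁ : ℝ) * Real.sqrt (D : ℝ)) ^ m := by

  have hx1 : 2 ≤ x₁ := by
    have : 0 < D * y₁ ^ 2 := by positivity
    nlinarith
  have hfund : Pell.IsFundamental (Pell.Solution₁.mk x₁ y₁ hsol₁) := by
    refine ⟨by simp; linarith, by simpa using hy₁, ?_⟩
    intro a ha
    rw [Pell.Solution₁.x_mk]
    by_contra! hlt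
    have hp := a.prop
    have hy0 : a.y ≠ 0 := by
      intro h0; rw [h0] at hp; nlinarith
    have hp' : a.x ^ 2 - D * |a.y| ^ 2 = 1 := by rw [sq_abs]; exact hp
    have h := hmin a.x |a.y| (by linarith) (abs_pos.mpr hy0) hp'
    have hlt2 : |a.y| < y₁ := by
      by_contra! hge
      have : D * y₁ ^ 2 ≤ D * |a.y| ^ 2 := by gcongr
      nlinarith
    have r1 : (a.x : ℝ) < x₁ := by exact_mod_cast hlt
    have r2 : ((|a.y| : ℤ) : ℝ) ≤ y₁ := by exact_mod_cast hlt2.le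
    have := mul_le_mul_of_nonneg_right r2 (Real.sqrt_nonneg (D : ℝ))
    linarith
  obtain ⟨m, hm⟩ := hfund.eq_pow_of_nonneg (a := Pell.Solution₁.mk x y hsol)
    (by simpa using hx) (by simpa using hy.le)
  have hz : (⟨x, y⟩ : ℤ√D) = (⟨x₁, y₁⟩ : ℤ√D) ^ m := by
    have := congrArg (fun s : Pell.Solution₁ D => (s : ℤ√D)) hm
    simp only [Pell.Solution₁.mk] at this
    exact this
  have hm0 : m ≠ 0 := by
    rintro rfl
    have := congrArg Zsqrtd.im hz
    simp at this; omega
  have hE : x₁ ^ 2 = 1 + D * y₁ ^ 2 := by linarith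
  have hyU : y = y₁ * ((⟨x₁, 1⟩ : ℤ√(D * y₁ ^ 2)) ^ m).im := by
    have := congrArg Zsqrtd.im hz
    rw [Stormer.scale] at this
    exact this
  have hno : ¬ Stormer.Three (D * y₁ ^ 2) ((⟨x₁, 1⟩ : ℤ√(D * y₁ ^ 2)) ^ m).im := by
    rintro ⟨s, t, w, hs, ht, hw, hst, hsw, htw, ds, dt, dw, ns, nt, nw⟩
    have key : ∀ p : ℕ, p.Prime → (p : ℤ) ∣ ((⟨x₁, 1⟩ : ℤ√(D * y₁ ^ 2)) ^ m).im →
        ¬ (p : ℤ) ∣ D * y₁ ^ 2 → p = p₁ ∨ p = p₂ := by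
      intro p hp hd hn
      have hpz := Nat.prime_iff_prime_int.mp hp
      have hpy : (p : ℤ) ∣ y := by rw [hyU]; exact hd.mul_left _
      rw [hyy] at hpy
      rcases hpz.dvd_or_dvd hpy with h | h
      · rcases hpz.dvd_or_dvd h with h | h
        · exact Or.inl (Stormer.p_eq hp hp₁ (hpz.dvd_of_dvd_pow h))
        · exact Or.inr (Stormer.p_eq hp hp₂ (hpz.dvd_of_dvd_pow h))
      · exact absurd ((hdiv p hp h).mul_right _) hn
    have k1 := key s hs ds ns
    have k2 := key t ht dt nt
    have k3 := key w hw dw nw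
    omega
  refine ⟨m, ?_, ?_⟩
  · have := Stormer.classify m hm0
      (fun h => hno ((Stormer.three_eight x₁ _ hx1 hE).mono (Stormer.im_dvd_im _ _ h)))
      (fun q hq ho h => hno ((Stormer.three_two_q x₁ _ hx1 hE hq ho).mono
        (Stormer.im_dvd_im _ _ h)))
      (fun q r hq hr hne hqo hro h => hno ((Stormer.three_qr x₁ _ hx1 hE hq hr hne hqo hro).mono
        (Stormer.im_dvd_im _ _ h)))
    rcases this with h | h | h | h <;> simp only [h, true_or, or_true]
  · rw [← Stormer.real_pow D x₁ y₁ hD m, ← hz]
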